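/- arXiv:2104.11630 — 2 statements merged into one kernel-verified Lean document; each statement's English description precedes it below -/
import Mathlib

section
/- For every r ∈ (0,1), K(r) < (π[16 − 5 log(1 − r²)] + 2δ r²)/(32 + 2(5π − 16)r²) − λ r², where λ = 8/5 − log 4 and δ = 128/5 − 32 log 2 − 17π/2 + 5π²/2. -/
open Real Set Filter Topology

/-- The complete elliptic integral of the first kind. -/
noncomputable def K (r : ℝ) : ℝ :=
  ∫ t in (0:ℝ)..(π/2), (1 - r^2 * Real.sin t ^ 2) ^ (-(1:ℝ)/2)

/-- central coefficients -/
noncomputable def bb (n : ℕ) : ℝ := ∏ i ∈ Finset.range n, ((2 * (i:ℝ) + 1) / (2 * i + 2))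

lemma bb_succ (n : ℕ) : bb (n+1) = bb n * ((2 * (n:ℝ) + 1) / (2 * n + 2)) :=
  Finset.prod_range_succ _ _

lemma bb_pos (n : ℕ) : 0 < bb n := Finset.prod_pos fun i _ => by positivity

lemma bb_choose (n : ℕ) : Ring.choose (-(1:ℝ)/2) n * (-1)^n = bb n := by
  induction n with
  | zero => simp [bb]
  | succ n ih =>
    rw [bb_succ, ← ih, Ring.choose_eq_smul, Ring.choose_eq_smul, descPochhammer_succ_right,
      Polynomial.smeval_mul, Nat.factorial_succ]
    simp only [Polynomial.smeval_sub, Polynomial.smeval_X, Polynomial.smeval_natCast, smul_eq_mul, pow_zero, pow_one, nsmul_eq_mul, mul_one]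
    have : (n.factorial : ℝ) ≠ 0 := by positivity
    have : (n:ℝ) + 1 ≠ 0 := by positivity
    push_cast
    field_simp
    ring

lemma hasSum_bb (u : ℝ) (h0 : 0 ≤ u) (h1 : u < 1) :
    HasSum (fun n => bb n * u^n) ((1 - u) ^ (-(1:ℝ)/2)) := by
  have h := (Real.one_add_rpow_hasFPowerSeriesOnBall_zero (a := -(1:ℝ)/2)).hasSum (y := -u)
    (by
      simp only [Metric.mem_eball, edist_zero_right, enorm_neg]
      rw [Real.enorm_eq_ofReal h0]
      simpa using h1)
  simp only [binomialSeries_apply, List.ofFn_const, List.prod_replicate, smul_eq_mul,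
    zero_add] at h
  rw [← sub_eq_add_neg] at h
  have e : (fun n => bb n * u^n) = fun n => Ring.choose (-(1:ℝ)/2) n * (-u)^n := by
    funext n
    rw [← bb_choose, neg_pow u]
    ring
  rw [e]
  exact h

lemma int_sin (n : ℕ) : ∫ t in (0:ℝ)..(π/2), Real.sin t ^ (2*n) = π/2 * bb n := by
  induction n with
  | zero => simp [bb]
  | succ n ih =>
    rw [show 2*(n+1) = 2*n+2 by ring, integral_sin_pow, ih, bb_succ]
    simp
    ring

lemma bb_sq_le (n : ℕ) (hn : 0 < n) : bb n ^ 2 * (π * n) ≤ 1 := by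
  have hW : ∀ k, Real.Wallis.W k * (bb k ^ 2 * (2 * k + 1)) = 1 := by
    intro k
    induction k with
    | zero => simp [bb, Real.Wallis.W]
    | succ k ih =>
      rw [bb_succ, Real.Wallis.W_succ]
      refine Eq.trans ?_ ih
      push_cast
      field_simp
      ring
  have h := Real.Wallis.le_W n
  have hb : 0 < bb n ^ 2 * (2 * n + 1) := by have := bb_pos n; positivity
  have h2 := mul_le_mul_of_nonneg_right h hb.le
  rw [hW] at h2
  refine le_trans ?_ h2
  have : bb n ^ 2 * (π * n) ≤ bb n ^ 2 * (π * ((2 * n + 1)^2 / (2 * (2 * n + 2)))) := by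
    have : (n:ℝ) ≤ ((2 * n + 1)^2 / (2 * (2 * n + 2))) := by
      rw [le_div_iff₀ (by positivity)]; nlinarith
    gcongr
  refine this.trans (le_of_eq ?_)
  field_simp

lemma hasSum_K (r : ℝ) (hr : r ∈ Ioo (0:ℝ) 1) :
    HasSum (fun n => π/2 * bb n ^ 2 * (r^2)^n) (K r) := by
  obtain ⟨h0, h1⟩ := hr
  have hx1 : r^2 < 1 := by nlinarith
  have h := intervalIntegral.hasSum_integral_of_dominated_convergence
    (μ := MeasureTheory.volume) (a := 0) (b := π/2)
    (F := fun n t => bb n * (r^2 * Real.sin t ^ 2)^n)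
    (f := fun t => (1 - r^2 * Real.sin t ^ 2) ^ (-(1:ℝ)/2))
    (fun n _ => bb n * (r^2)^n)
    (fun n => (by fun_prop : Continuous _).aestronglyMeasurable)
    (fun n => MeasureTheory.ae_of_all _ fun t _ => ?_)
    (MeasureTheory.ae_of_all _ fun t _ => (hasSum_bb _ (by positivity) hx1).summable)
    (by simp)
    (MeasureTheory.ae_of_all _ fun t _ => hasSum_bb _ (by positivity) ?_)
  · have e : (fun n => π/2 * bb n ^ 2 * (r^2)^n) =
        fun n => ∫ t in (0:ℝ)..(π/2), bb n * (r^2 * Real.sin t ^ 2)^n := by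
      funext n
      simp only [mul_pow, ← pow_mul, intervalIntegral.integral_const_mul, int_sin]
      ring
    rw [e]
    exact h
  · have hb := bb_pos n
    rw [Real.norm_of_nonneg (by positivity)]
    have : r^2 * Real.sin t ^ 2 ≤ r^2 := mul_le_of_le_one_right (by positivity) (Real.sin_sq_le_one t)
    gcongr
  · have : r^2 * Real.sin t ^ 2 ≤ r^2 := mul_le_of_le_one_right (by positivity) (Real.sin_sq_le_one t)
    linarith

lemma key (r : ℝ) (hr : r ∈ Ioo (0:ℝ) 1) :
    0 ≤ 5 * π * (-Real.log (1 - r^2) - r^2 - (r^2)^2/2)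
      - 32 * (K r - π/2 - π/8 * r^2 - 9*π/128 * (r^2)^2)
      - (10*π - 32) * (r^2 * (K r - π/2 - π/8 * r^2)) := by
  have hK := hasSum_K r hr
  obtain ⟨h0, h1⟩ := hr
  have hx1 : r^2 < 1 := by nlinarith
  have hx0 : 0 < r^2 := by positivity
  set x := r^2
  have hL := Real.hasSum_pow_div_log_of_abs_lt_one (x := x) (by rwa [abs_of_pos hx0])
  have hL2 := (hasSum_nat_add_iff' 2).2 hL
  have hK2 := (hasSum_nat_add_iff' 2).2 hK
  have hK3 := (hasSum_nat_add_iff' 3).2 hK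
  have H := ((hL2.mul_left (5*π)).sub (hK3.mul_left 32)).sub ((hK2.mul_left x).mul_left (10*π-32))
  have H2 := H.nonneg ?_
  · simp [Finset.sum_range_succ, bb, Finset.prod_range_succ] at H2
    norm_num at H2
    linarith
  · intro n
    have hb := bb_sq_le (n+3) (by omega)
    have e : bb (n+3) = bb (n+2) * ((2 * ((n+2:ℕ):ℝ) + 1) / (2 * ((n+2:ℕ):ℝ) + 2)) := bb_succ (n+2)
    have hle : bb (n+3) ^ 2 ≤ bb (n+2) ^ 2 := by
      have := bb_pos (n+2)
      have := bb_pos (n+3)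
      have : bb (n+3) ≤ bb (n+2) := by
        rw [e]
        apply mul_le_of_le_one_right (by positivity)
        rw [div_le_one (by positivity)]; linarith
      gcongr
    have hp : π < 3.2 := by linarith [Real.pi_lt_d2]
    have hm : 0 ≤ 5 * π / (n+3) - 32 * (π/2 * bb (n+3)^2) - (10*π-32) * (π/2 * bb (n+2)^2) := by
      have : 10 * π * bb (n+3)^2 ≤ 10 / (n+3) := by
        rw [le_div_iff₀ (by positivity)]
        push_cast at hb
        linarith
      have h5 : 5 * π / ((n:ℝ)+3) = π/2 * (10 / (n+3)) := by ring
      rw [h5]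
      have : 0 ≤ π/2 * (10/((n:ℝ)+3) - 32 * bb (n+3)^2 - (10*π-32) * bb (n+2)^2) := by
        apply mul_nonneg (by positivity)
        nlinarith
      linarith
    have hm2 := mul_nonneg hm (pow_pos hx0 (n+3)).le
    refine hm2.trans (le_of_eq ?_)
    push_cast
    ring

theorem K_upper_g (r : ℝ) (hr : r ∈ Ioo (0:ℝ) 1) :
    K r < (π * (16 - 5 * Real.log (1 - r^2)) + 2 * (128/5 - 32 * Real.log 2 - 17*π/2 + 5*π^2/2) * r^2) /
        (32 + 2*(5*π - 16)*r^2) - (8/5 - Real.log 4) * r^2 := by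
  have hk := key r hr
  obtain ⟨h0, h1⟩ := hr
  have hx1 : r^2 < 1 := by nlinarith
  have hx0 : 0 < r^2 := by positivity
  set x := r^2
  have hp : π < 3.2 := by linarith [Real.pi_lt_d2]
  have hp3 := Real.pi_gt_three
  have hD : 0 < 32 + 2*(5*π - 16)*x := by nlinarith
  have h4 : Real.log 4 = 2 * Real.log 2 := by
    rw [show (4:ℝ) = 2^2 by norm_num, Real.log_pow]; norm_num
  have hl : 0 < 8/5 - 2 * Real.log 2 := by linarith [Real.log_two_lt_d9]
  rw [lt_sub_iff_add_lt, lt_div_iff₀ hD, h4]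
  have hc : 0 < (π/4 + (32-10*π)*(8/5 - 2 * Real.log 2 + π/8)) * x^2 := by
    have : 0 < 32 - 10*π := by linarith
    positivity
  nlinarith
end

section
/- For every r ∈ (0,1), K(r) > (π[16 − 5 log(1 − r²)] − 2[α + (β − α)r] r⁴)/(32 + 2(5π − 16)r²) − θ r², where θ = π(17 − 5π)/32, α = 85π/8 − 185π²/32 + 25π³/32 and β = (8 − 10 log 2)π − 85π²/32 + 25π³/32. -/
open Real Set Filter Topology

noncomputable def cc (n : ℕ) : ℝ := ∏ i ∈ Finset.range n, (2 * (i : ℝ) + 1) / (2 * i + 2)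

lemma cc_succ (n : ℕ) : cc (n+1) = cc n * ((2 * (n : ℝ) + 1) / (2 * n + 2)) :=
  Finset.prod_range_succ _ _

lemma cc_zero : cc 0 = 1 := by simp [cc]

lemma cc_pos (n : ℕ) : 0 < cc n := Finset.prod_pos (fun i _ => by positivity)

lemma choose_cc (n : ℕ) : Ring.choose (-(1:ℝ)/2) n = (-1)^n * cc n := by
  induction n with
  | zero => simp [cc]
  | succ n ih =>
    have h1 := Ring.descPochhammer_eq_factorial_smul_choose (-(1:ℝ)/2) n
    have h2 := Ring.descPochhammer_eq_factorial_smul_choose (-(1:ℝ)/2) (n+1)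
    rw [descPochhammer_succ_right, Polynomial.smeval_mul, h1] at h2
    simp [Polynomial.smeval_natCast, Nat.factorial_succ, ih] at h2
    have hf : (n.factorial : ℝ) ≠ 0 := by positivity
    have hn : (n : ℝ) + 1 ≠ 0 := by positivity
    rw [cc_succ]
    have h3 : ((n:ℝ)+1) * Ring.choose (-(1:ℝ)/2) (n+1) = ((-1)^n * cc n) * (-1/2 - n) := by
      apply mul_left_cancel₀ hf
      linarith
    apply mul_left_cancel₀ hn
    rw [h3]
    field_simp
    ring

lemma hasSum_rpow (y : ℝ) (h0 : 0 ≤ y) (h1 : y < 1) :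
    HasSum (fun n => cc n * y^n) ((1 - y) ^ (-(1:ℝ)/2)) := by
  have h := (Real.one_add_rpow_hasFPowerSeriesOnBall_zero (a := -(1:ℝ)/2)).hasSum (y := -y)
    (by simp [abs_of_nonneg h0, enorm_eq_nnnorm, ← NNReal.coe_lt_one, h1])
  simp only [binomialSeries_apply, choose_cc] at h
  convert! h using 2 with n
  · simp [List.ofFn_const, neg_pow y n]
    rw [mul_mul_mul_comm]
    ring_nf
    simp
  · ring

lemma sin_half (n : ℕ) : ∫ t in (0:ℝ)..(π/2), sin t ^ (2*n) = π/2 * cc n := by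
  have h := integral_sin_pow_even (n := n)
  have h2 : ∫ t in (π/2:ℝ)..π, sin t ^ (2*n) = ∫ t in (0:ℝ)..(π/2), sin t ^ (2*n) := by
    have := intervalIntegral.integral_comp_sub_left (fun t => sin t ^ (2*n)) π (a := 0) (b := π/2)
    simp only [sin_pi_sub] at this
    rw [this]
    congr 1 <;> ring
  have h3 := intervalIntegral.integral_add_adjacent_intervals (μ := MeasureTheory.volume)
    (f := fun t => sin t ^ (2*n)) (a := 0) (b := π/2) (c := π)
    (Continuous.intervalIntegrable (by fun_prop) _ _) (Continuous.intervalIntegrable (by fun_prop) _ _)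
  rw [h2, h] at h3
  unfold cc
  linarith

lemma K_series (r : ℝ) (hr : r ∈ Ioo (0:ℝ) 1) :
    HasSum (fun n => π/2 * cc n ^ 2 * (r^2)^n) (K r) := by
  obtain ⟨h0, h1⟩ := hr
  have hr2 : r^2 < 1 := by nlinarith
  have key := intervalIntegral.hasSum_integral_of_dominated_convergence (μ := MeasureTheory.volume)
    (a := 0) (b := π/2) (F := fun n t => cc n * (r^2 * sin t ^ 2)^n)
    (f := fun t => (1 - r^2 * Real.sin t ^ 2) ^ (-(1:ℝ)/2))
    (fun n _ => cc n * (r^2)^n)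
    (fun n => Continuous.aestronglyMeasurable (by fun_prop))
    (fun n => Eventually.of_forall fun t _ => by
      have hs : sin t ^ 2 ≤ 1 := sin_sq_le_one t
      rw [Real.norm_of_nonneg (mul_nonneg (cc_pos n).le (by positivity))]
      gcongr
      · exact (cc_pos n).le
      · nlinarith [sq_nonneg r])
    (Eventually.of_forall fun t _ => (hasSum_rpow (r^2) (by positivity) hr2).summable)
    (by simp)
    (Eventually.of_forall fun t _ => hasSum_rpow _ (by positivity) (by
      have hs : sin t ^ 2 ≤ 1 := sin_sq_le_one t
      nlinarith [sq_nonneg r]))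
  unfold K
  convert! key using 2 with n
  simp_rw [mul_pow, ← pow_mul]
  rw [intervalIntegral.integral_const_mul, intervalIntegral.integral_const_mul, sin_half]
  ring

lemma cc_wallis (n : ℕ) : π * n * cc n ^ 2 < 1 := by
  have hW : Real.Wallis.W n * ((2*n+1) * cc n ^ 2) = 1 := by
    induction n with
    | zero => simp [Real.Wallis.W, cc]
    | succ n ih =>
      rw [Real.Wallis.W_succ, cc_succ]
      push_cast
      refine Eq.trans ?_ ih
      field_simp
      ring
  have h := Real.Wallis.le_W n
  have hc := cc_pos n
  have h2 : ((2 : ℝ) * n + 1) / (2 * n + 2) * (π / 2) * ((2*n+1) * cc n ^ 2) ≤ 1 := by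
    refine le_trans ?_ hW.le
    gcongr
  have h3 : (2 * (n:ℝ) + 1)^2 * (π * cc n ^ 2) ≤ 4 * (n + 1) := by
    have : ((2 : ℝ) * n + 1) / (2 * n + 2) * (π / 2) * ((2*n+1) * cc n ^ 2)
      = (2 * (n:ℝ) + 1)^2 * (π * cc n ^ 2) / (4 * (n+1)) := by field_simp; ring
    rw [this, div_le_one (by positivity)] at h2
    exact h2
  have hp : 0 < π * cc n ^ 2 := by positivity
  have hn : (0:ℝ) ≤ n := by positivity
  by_contra hcon
  push Not at hcon
  nlinarith

lemma K_lower_log (k : ℝ) (hk : 0 < k) (hk1 : k < 1) :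
    log 4 - log k - k * (π/2) ≤ K (√(1-k^2)) := by
  have hsq : √(1-k^2)^2 = 1 - k^2 := Real.sq_sqrt (by nlinarith)
  have hW : ∀ t : ℝ, 0 < √(cos t ^ 2 + k^2) := fun t => by positivity
  have hder : ∀ t ∈ uIcc (0:ℝ) (π/2), HasDerivAt (fun t => -arsinh (cos t / k) + log (1 + sin t) - k * t)
      (sin t / √(cos t ^ 2 + k^2) + cos t / (1 + sin t) - k) t := by
    intro t ht
    rw [uIcc_of_le (by positivity)] at ht
    have hs : 0 ≤ sin t := sin_nonneg_of_nonneg_of_le_pi ht.1 (by linarith [ht.2, pi_pos])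
    have e1 := (((hasDerivAt_cos t).div_const k).arsinh).neg
    have e2 := ((hasDerivAt_sin t).const_add 1).log (by positivity)
    have e3 := (hasDerivAt_id t).const_mul k
    convert! (e1.add e2).sub e3 using 1
    have : √(1 + (cos t / k)^2) = √(cos t ^ 2 + k^2) / k := by
      rw [eq_div_iff hk.ne']
      nth_rewrite 2 [← Real.sqrt_sq hk.le]
      rw [← Real.sqrt_mul (by positivity)]
      congr 1
      field_simp
      ring
    rw [this]
    have := hW t
    simp
    field_simp
  have hcont1 : ContinuousOn (fun t => sin t / √(cos t ^ 2 + k^2) + cos t / (1 + sin t) - k) (uIcc (0:ℝ) (π/2)) := by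
    rw [uIcc_of_le (by positivity)]
    refine ((ContinuousOn.div (by fun_prop) (by fun_prop) fun t _ => (hW t).ne').add
      (ContinuousOn.div (by fun_prop) (by fun_prop) fun t ht => ?_)).sub (by fun_prop)
    have hs : 0 ≤ sin t := sin_nonneg_of_nonneg_of_le_pi ht.1 (by linarith [ht.2, pi_pos])
    positivity
  have hpos : ∀ t, 0 < 1 - (1 - k^2) * sin t ^ 2 := fun t => by
    have hs : sin t ^ 2 ≤ 1 := sin_sq_le_one t
    nlinarith [sq_nonneg (sin t), sq_pos_of_pos hk]
  have hint := intervalIntegral.integral_eq_sub_of_hasDerivAt hder hcont1.intervalIntegrable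
  have hle : (∫ t in (0:ℝ)..(π/2), (sin t / √(cos t ^ 2 + k^2) + cos t / (1 + sin t) - k)) ≤ K (√(1-k^2)) := by
    unfold K
    rw [hsq]
    refine intervalIntegral.integral_mono_on (by positivity) hcont1.intervalIntegrable ?_ ?_
    · apply Continuous.intervalIntegrable
      exact Continuous.rpow_const (by fun_prop) fun t => Or.inl (hpos t).ne'
    · intro t ht
      have hs : 0 ≤ sin t := sin_nonneg_of_nonneg_of_le_pi ht.1 (by linarith [ht.2, pi_pos])
      have hc : 0 ≤ cos t := cos_nonneg_of_neg_pi_div_two_le_of_le (by linarith [ht.1, pi_pos]) ht.2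
      have hsc := sin_sq_add_cos_sq t
      have e : (1 - (1 - k^2) * sin t ^ 2) ^ (-(1:ℝ)/2) = 1 / √(1 - (1 - k^2) * sin t ^ 2) := by
        rw [Real.sqrt_eq_rpow, one_div, ← Real.rpow_neg (hpos t).le]
        norm_num
      rw [e]
      have e2 : 1 / √(cos t ^ 2 + k^2) ≤ 1 / √(1 - (1 - k^2) * sin t ^ 2) := by
        apply one_div_le_one_div_of_le (Real.sqrt_pos.mpr (hpos t))
        apply Real.sqrt_le_sqrt
        nlinarith [sq_nonneg (cos t), sq_pos_of_pos hk, mul_nonneg (sq_nonneg k) (sq_nonneg (cos t))]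
      refine le_trans ?_ e2
      have hw := hW t
      have hw2 : √(cos t ^ 2 + k^2) ≤ cos t + k := by
        rw [Real.sqrt_le_left (by positivity)]
        nlinarith
      set w := √(cos t ^ 2 + k^2)
      set s := sin t
      set c := cos t
      have h1 : (c - k) * w ≤ c^2 := by
        rcases le_total c k with h | h
        · nlinarith [mul_nonneg (sub_nonneg.2 h) hw.le]
        · nlinarith [mul_le_mul_of_nonneg_left hw2 (sub_nonneg.2 h)]
      have h2 : 1 / w - (s / w + c / (1 + s) - k) = (c^2 - (c - k * (1+s)) * w) / (w * (1+s)) := by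
        field_simp
        rw [← sub_eq_zero]
        ring_nf
        linear_combination -hsc
      have h3 : 0 ≤ (c^2 - (c - k * (1+s)) * w) / (w * (1+s)) := by
        apply div_nonneg _ (by positivity)
        nlinarith [mul_nonneg (mul_nonneg hk.le hs) hw.le]
      linarith
  rw [hint] at hle
  simp at hle
  have hars : log 2 - log k ≤ arsinh k⁻¹ := by
    rw [← Real.log_div (by norm_num) hk.ne']
    unfold Real.arsinh
    apply Real.log_le_log (by positivity)
    have : k⁻¹ ≤ √(1 + k⁻¹^2) := Real.le_sqrt_of_sq_le (by linarith)
    rw [div_eq_mul_inv]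
    linarith
  have h4 : log 4 = 2 * log 2 := by
    rw [show (4:ℝ) = 2^2 by norm_num, Real.log_pow]; norm_num
  have h11 : (1:ℝ) + 1 = 2 := by norm_num
  rw [h11] at hle
  linarith

noncomputable def pp (n : ℕ) : ℝ :=
  5*π/(n+3) - 16*π*cc (n+3)^2 + π*(16 - 5*π)*cc (n+2)^2

lemma pp_pos (n : ℕ) : 0 < pp n := by
  have h := cc_wallis (n+3)
  have hlt : cc (n+3) ≤ cc (n+2) := by
    rw [show n+3 = (n+2)+1 by ring, cc_succ]
    have := cc_pos (n+2)
    apply mul_le_of_le_one_right this.le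
    rw [div_le_one (by positivity)]
    linarith
  have h2 : cc (n+3)^2 ≤ cc (n+2)^2 := by
    have := cc_pos (n+3)
    gcongr
  have hpi : 0 < 16 - 5*π := by linarith [Real.pi_lt_d2]
  have hp := Real.pi_pos
  have h3 : π * cc (n+3)^2 < 1/(n+3) := by
    rw [lt_div_iff₀ (by positivity)]
    push_cast at h
    linarith
  have h4 : π*(16 - 5*π)*cc (n+3)^2 ≤ π*(16 - 5*π)*cc (n+2)^2 := by gcongr
  have h5 : 5*π/(n+3) = 5*π*(1/(n+3)) := by ring
  unfold pp
  rw [h5]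
  nlinarith

noncomputable def PP (r : ℝ) : ℝ :=
  π * (16 - 5 * Real.log (1 - r^2)) - 2 * (85*π/8 - 185*π^2/32 + 25*π^3/32) * r^4
    - (32 + 2*(5*π - 16)*r^2) * (K r + π * (17 - 5*π) / 32 * r^2)

lemma PP_series (r : ℝ) (hr : r ∈ Ioo (0:ℝ) 1) :
    HasSum (fun n => pp n * (r^2)^(n+3)) (PP r) := by
  have hK := K_series r hr
  have hr2 : r^2 < 1 := by nlinarith [hr.1, hr.2]
  have hL := Real.hasSum_pow_div_log_of_abs_lt_one (x := r^2) (by rwa [abs_of_nonneg (by positivity)])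
  have k3 := (hasSum_nat_add_iff' 3).mpr hK
  have k2 := (hasSum_nat_add_iff' 2).mpr hK
  have l2 := (hasSum_nat_add_iff' 2).mpr hL
  have := ((l2.mul_left (5*π)).sub (k3.mul_left 32)).add (k2.mul_left (2*(16-5*π)*r^2))
  convert! this using 1
  · ext n
    unfold pp
    push_cast
    rw [show (n:ℝ) + 2 + 1 = n + 3 by ring]
    ring
  · simp [Finset.sum_range_succ, cc]
    unfold PP
    ring

lemma PP_mono (r s : ℝ) (hr : r ∈ Ioo (0:ℝ) 1) (hs : s ∈ Ioo (0:ℝ) 1) (h : r ≤ s) :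
    PP r * s^6 ≤ r^6 * PP s := by
  refine hasSum_le ?_ ((PP_series r hr).mul_right (s^6)) ((PP_series s hs).mul_left (r^6))
  intro n
  have h0 := hr.1
  have := pp_pos n
  calc pp n * (r^2)^(n+3) * s^6 = pp n * (r^2)^n * (r^6 * s^6) := by ring
    _ ≤ pp n * (s^2)^n * (r^6*s^6) := by gcongr
    _ = _ := by ring

noncomputable def QQ (k : ℝ) : ℝ :=
  16*π - 2 * (85*π/8 - 185*π^2/32 + 25*π^3/32) * (1-k^2)^2
    - (32 + 2*(5*π - 16)*(1-k^2)) * (log 4 - k*(π/2) + π * (17 - 5*π) / 32 * (1-k^2))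
    + 2*(16-5*π) * (k * (k * log k))

lemma QQ_cont : Continuous QQ := by
  have := Real.continuous_mul_log
  unfold QQ
  fun_prop

lemma PP_le_QQ (k : ℝ) (hk : 0 < k) (hk1 : k < 1) : PP (√(1-k^2)) ≤ QQ k := by
  have hsq : √(1-k^2)^2 = 1 - k^2 := Real.sq_sqrt (by nlinarith)
  have h := K_lower_log k hk hk1
  unfold PP QQ
  rw [show √(1-k^2)^4 = (√(1-k^2)^2)^2 by ring, hsq, show 1 - (1 - k^2) = k^2 by ring, Real.log_pow]
  have hD : 0 ≤ 32 + 2*(5*π - 16)*(1-k^2) := by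
    nlinarith [Real.pi_gt_three, Real.pi_lt_d2, sq_nonneg k, mul_pos hk hk]
  have := mul_le_mul_of_nonneg_left h hD
  push_cast
  linarith

lemma PP_bound (r : ℝ) (hr : r ∈ Ioo (0:ℝ) 1) : PP r ≤ r^6 * QQ 0 := by
  have hq : Tendsto (fun k => r^6 * QQ k - PP r * (1-k^2)^3) (𝓝[>] 0) (𝓝 (r^6 * QQ 0 - PP r * (1-0^2)^3)) := by
    have : Continuous (fun k => r^6 * QQ k - PP r * (1-k^2)^3) := by
      have := QQ_cont
      fun_prop
    exact (this.tendsto 0).mono_left nhdsWithin_le_nhds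
  have hr2 : 0 < 1 - r^2 := by nlinarith [hr.1, hr.2]
  have hev : ∀ᶠ k in 𝓝[>] (0:ℝ), 0 ≤ r^6 * QQ k - PP r * (1-k^2)^3 := by
    have hm : Ioo (0:ℝ) (√(1-r^2)) ∈ 𝓝[>] (0:ℝ) := Ioo_mem_nhdsGT (Real.sqrt_pos.mpr hr2)
    filter_upwards [hm] with k hk
    have hk2 : k^2 < 1 - r^2 := (Real.lt_sqrt hk.1.le).mp hk.2
    have hk1 : k < 1 := by nlinarith [hk.1, sq_nonneg r]
    have hsq : √(1-k^2)^2 = 1 - k^2 := Real.sq_sqrt (by nlinarith [sq_nonneg r])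
    have h1 := PP_mono r (√(1-k^2)) hr ⟨Real.sqrt_pos.mpr (by nlinarith [sq_nonneg r]),
      by rw [Real.sqrt_lt' one_pos]; nlinarith [mul_pos hk.1 hk.1]⟩ (Real.le_sqrt_of_sq_le (by linarith))
    rw [show √(1-k^2)^6 = (√(1-k^2)^2)^3 by ring, hsq] at h1
    have h2 := mul_le_mul_of_nonneg_left (PP_le_QQ k hk.1 hk1) (by have := hr.1; positivity : 0 ≤ r^6)
    linarith
  have := ge_of_tendsto hq hev
  linarith

theorem K_lower_f (r : ℝ) (hr : r ∈ Ioo (0:ℝ) 1) :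
    (π * (16 - 5 * Real.log (1 - r^2)) -
        2 * ((85*π/8 - 185*π^2/32 + 25*π^3/32) + (((8 - 10 * Real.log 2) * π - 85*π^2/32 + 25*π^3/32) - (85*π/8 - 185*π^2/32 + 25*π^3/32)) * r) * r^4) /
        (32 + 2*(5*π - 16)*r^2) - π * (17 - 5*π) / 32 * r^2 < K r := by
  have hb := PP_bound r hr
  have hpos : 0 < PP r := by
    have hs := PP_series r hr
    have h0 := hr.1
    have hp : ∀ n, 0 < pp n * (r^2)^(n+3) := fun n => mul_pos (pp_pos n) (by positivity)
    rw [← hs.tsum_eq]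
    exact hs.summable.tsum_pos (fun n => (hp n).le) 0 (hp 0)
  obtain ⟨h0, h1⟩ := hr
  have hQ : 0 < QQ 0 := by
    by_contra hcon
    push Not at hcon
    nlinarith [mul_nonneg (by positivity : 0 ≤ r^6) (neg_nonneg.2 hcon)]
  have hlt : PP r < r^5 * QQ 0 := by
    refine hb.trans_lt ?_
    have : r^6 < r^5 := pow_lt_pow_right_of_lt_one₀ h0 h1 (by norm_num)
    gcongr
  have hD : 0 < 32 + 2*(5*π - 16)*r^2 := by
    nlinarith [Real.pi_gt_three, Real.pi_lt_d2, mul_pos h0 h0]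
  rw [sub_lt_iff_lt_add, div_lt_iff₀ hD]
  have h4 : log 4 = 2 * log 2 := by
    rw [show (4:ℝ) = 2^2 by norm_num, Real.log_pow]; norm_num
  unfold PP QQ at hlt
  rw [h4] at hlt
  simp only [mul_zero, zero_mul] at hlt
  linarith
end
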